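/- (Necessity of the dimensional balance in the weighted Caffarelli–Kohn–Nirenberg inequality.) Let p, q, r, a, α, β, σ be real numbers with 1 < p < Q, q ≥ 1, r > 0, 0 ≤ a ≤ 1, and set γ = aσ + (1−a)β. Assume d + μ(α−γ)r > 0, d + μ(α−β)q > 0, αp + Q > 0, βq + Q > 0, γr + Q > 0. If there exists a constant C > 0 such that for every u ∈ C_0^∞(ℝ^{d+k}) one has (∫_{ℝ^{d+k}} (|x|^μ/ρ^μ)^{(α−γ)r} ρ^{γr} |u|^r dx dy)^{1/r} ≤ C (∫_{ℝ^{d+k}} ρ^{αp} |∇_μ u|^p dx dy)^{a/p} (∫_{ℝ^{d+k}} (|x|^μ/ρ^μ)^{(α−β)q} ρ^{βq} |u|^q dx dy)^{(1−a)/q}, then necessarily 1/r + γ/Q = a(1/p + (α−1)/Q) + (1−a)(1/q + β/Q). -/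

import Mathlib

open MeasureTheory Real
open scoped RealInnerProductSpace ENNReal

/-- The anisotropic distance function `ρ(x,y) = (|x|^{2+2μ} + (1+μ)²|y|²)^{1/(2+2μ)}`. -/
noncomputable def grho (μ : ℝ) {d k : ℕ}
    (z : EuclideanSpace ℝ (Fin d) × EuclideanSpace ℝ (Fin k)) : ℝ :=
  (‖z.1‖ ^ (2 + 2 * μ) + (1 + μ) ^ 2 * ‖z.2‖ ^ 2) ^ (1 / (2 + 2 * μ))

/-- The Grushin gradient `∇_μ u = (∇_x u, |x|^μ ∇_y u)`. -/
noncomputable def gradMu (μ : ℝ) {d k : ℕ}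
    (u : EuclideanSpace ℝ (Fin d) × EuclideanSpace ℝ (Fin k) → ℝ)
    (z : EuclideanSpace ℝ (Fin d) × EuclideanSpace ℝ (Fin k)) :
    EuclideanSpace ℝ (Fin d) × EuclideanSpace ℝ (Fin k) :=
  (gradient (fun x => u (x, z.2)) z.1, (‖z.1‖ ^ μ) • gradient (fun y => u (z.1, y)) z.2)

/-- The Euclidean-type norm `((|v₁|² + |v₂|²))^{1/2}` of a pair. -/
noncomputable def pairNorm {d k : ℕ}
    (v : EuclideanSpace ℝ (Fin d) × EuclideanSpace ℝ (Fin k)) : ℝ :=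
  Real.sqrt (‖v.1‖ ^ 2 + ‖v.2‖ ^ 2)

/-- `|∇_μ u| = (|∇_x u|² + |x|^{2μ}|∇_y u|²)^{1/2}`. -/
noncomputable def gradMuNorm (μ : ℝ) {d k : ℕ}
    (u : EuclideanSpace ℝ (Fin d) × EuclideanSpace ℝ (Fin k) → ℝ)
    (z : EuclideanSpace ℝ (Fin d) × EuclideanSpace ℝ (Fin k)) : ℝ :=
  pairNorm (gradMu μ u z)

/-- The anisotropic dilation `(x, y) ↦ (l x, l^{1+μ} y)`, as a homeomorphism. -/
noncomputable def grushinDilation (μ : ℝ) (d k : ℕ) {l : ℝ} (hl : 0 < l) :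
    EuclideanSpace ℝ (Fin d) × EuclideanSpace ℝ (Fin k) ≃ₜ
      EuclideanSpace ℝ (Fin d) × EuclideanSpace ℝ (Fin k) :=
  (Homeomorph.smulOfNeZero l hl.ne').prodCongr
    (Homeomorph.smulOfNeZero (l ^ (1 + μ)) (rpow_pos_of_pos hl _).ne')

lemma grushinDilation_apply (μ : ℝ) {d k : ℕ} {l : ℝ} (hl : 0 < l)
    (z : EuclideanSpace ℝ (Fin d) × EuclideanSpace ℝ (Fin k)) :
    grushinDilation μ d k hl z = (l • z.1, l ^ (1 + μ) • z.2) := rfl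

lemma contDiff_grushinDilation (μ : ℝ) (d k : ℕ) {l : ℝ} (hl : 0 < l) :
    ContDiff ℝ (⊤ : ℕ∞) (grushinDilation μ d k hl) := by
  change ContDiff ℝ (⊤ : ℕ∞)
    fun z : EuclideanSpace ℝ (Fin d) × EuclideanSpace ℝ (Fin k) => (l • z.1, l ^ (1 + μ) • z.2)
  fun_prop

/-- Change of variables for the anisotropic dilation, valid without integrability. -/
lemma integral_comp_grushinDilation (μ : ℝ) {d k : ℕ} {l : ℝ} (hl : 0 < l)
    (f : EuclideanSpace ℝ (Fin d) × EuclideanSpace ℝ (Fin k) → ℝ) :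
    ∫ z, f (grushinDilation μ d k hl z) = l ^ (-(d + (1 + μ) * k)) * ∫ z, f z := by
  have hm : 0 < l ^ (1 + μ) := rpow_pos_of_pos hl _
  have hmap : Measure.map (grushinDilation μ d k hl) volume =
      ENNReal.ofReal (l ^ (-(d + (1 + μ) * k))) • volume := by
    change Measure.map (Prod.map (l • ·) (l ^ (1 + μ) • ·)) _ = _
    rw [Measure.volume_eq_prod,
      ← Measure.map_prod_map _ _ (measurable_const_smul l) (measurable_const_smul _),
      Measure.map_addHaar_smul _ hl.ne', Measure.map_addHaar_smul _ hm.ne',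
      Measure.prod_smul_left, Measure.prod_smul_right, smul_smul,
      ← ENNReal.ofReal_mul (abs_nonneg _)]
    congr 2
    rw [finrank_euclideanSpace_fin, finrank_euclideanSpace_fin, abs_of_pos (by positivity),
      abs_of_pos (by positivity), neg_add, rpow_add hl (-(d : ℝ)), rpow_neg hl.le, rpow_neg hl.le,
      rpow_natCast, rpow_mul hl.le, rpow_natCast]
  have h := (grushinDilation μ d k hl).measurableEmbedding.integral_map (μ := volume) f
  rw [← h, hmap, integral_smul_measure, ENNReal.toReal_ofReal (rpow_nonneg hl.le _), smul_eq_mul]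

/-- Scaling of integrals under a homogeneous change of variables. -/
lemma integral_eq_of_homogeneous (μ : ℝ) {d k : ℕ} {l : ℝ} (hl : 0 < l) (e : ℝ)
    {f g : EuclideanSpace ℝ (Fin d) × EuclideanSpace ℝ (Fin k) → ℝ}
    (h : ∀ z, f (grushinDilation μ d k hl z) = l ^ e * g z) :
    ∫ z, g z = l ^ (-e - (d + (1 + μ) * k)) * ∫ z, f z := by
  have h' := integral_comp_grushinDilation μ hl f
  simp_rw [h, integral_const_mul] at h'
  rw [sub_eq_add_neg, rpow_add hl, mul_assoc, ← h', ← mul_assoc, ← rpow_add hl]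
  simp

lemma grho_nonneg (μ : ℝ) {d k : ℕ}
    (z : EuclideanSpace ℝ (Fin d) × EuclideanSpace ℝ (Fin k)) : 0 ≤ grho μ z := by
  unfold grho; positivity

lemma grho_grushinDilation {μ : ℝ} (hμ : 0 < μ) {d k : ℕ} {l : ℝ} (hl : 0 < l)
    (z : EuclideanSpace ℝ (Fin d) × EuclideanSpace ℝ (Fin k)) :
    grho μ (grushinDilation μ d k hl z) = l * grho μ z := by
  have hm : 0 < l ^ (1 + μ) := rpow_pos_of_pos hl _
  have h2 : (l ^ (1 + μ)) ^ 2 = l ^ (2 + 2 * μ) := by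
    rw [← rpow_natCast, ← rpow_mul hl.le]; congr 1; push_cast; ring
  rw [grho, grho, grushinDilation_apply]
  simp only [norm_smul, norm_of_nonneg hl.le, norm_of_nonneg hm.le]
  rw [mul_rpow hl.le (norm_nonneg _), mul_pow, h2,
    show l ^ (2 + 2 * μ) * ‖z.1‖ ^ (2 + 2 * μ) + (1 + μ) ^ 2 * (l ^ (2 + 2 * μ) * ‖z.2‖ ^ 2) =
      l ^ (2 + 2 * μ) * (‖z.1‖ ^ (2 + 2 * μ) + (1 + μ) ^ 2 * ‖z.2‖ ^ 2) by ring,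
    mul_rpow (by positivity) (by positivity), ← rpow_mul hl.le,
    mul_one_div_cancel (by positivity), rpow_one]

lemma grho_pos {μ : ℝ} {d k : ℕ}
    {z : EuclideanSpace ℝ (Fin d) × EuclideanSpace ℝ (Fin k)} (hz : z.1 ≠ 0) :
    0 < grho μ z := by
  have := norm_pos_iff.2 hz
  unfold grho; positivity

lemma continuous_grho {μ : ℝ} (hμ : 0 < μ) (d k : ℕ) :
    Continuous (grho μ : EuclideanSpace ℝ (Fin d) × EuclideanSpace ℝ (Fin k) → ℝ) := by
  unfold grho
  refine Continuous.rpow_const ?_ fun _ => Or.inr (by positivity)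
  refine Continuous.add ?_ (by fun_prop)
  exact Continuous.rpow_const (by fun_prop) fun _ => Or.inr (by positivity)

lemma gradient_comp_const_smul {E : Type*} [NormedAddCommGroup E] [InnerProductSpace ℝ E]
    [CompleteSpace E] (f : E → ℝ) (c : ℝ) (x : E) :
    gradient (fun x => f (c • x)) x = c • gradient f (c • x) := by
  simp only [gradient]
  rw [fderiv_comp_smul]
  simp

lemma gradMuNorm_comp_grushinDilation (μ : ℝ) {d k : ℕ} {l : ℝ} (hl : 0 < l)
    (u : EuclideanSpace ℝ (Fin d) × EuclideanSpace ℝ (Fin k) → ℝ)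
    (z : EuclideanSpace ℝ (Fin d) × EuclideanSpace ℝ (Fin k)) :
    gradMuNorm μ (u ∘ grushinDilation μ d k hl) z =
      l * gradMuNorm μ u (grushinDilation μ d k hl z) := by
  have hm : 0 < l ^ (1 + μ) := rpow_pos_of_pos hl _
  have h1 := gradient_comp_const_smul (fun x => u (x, l ^ (1 + μ) • z.2)) l z.1
  have h2 := gradient_comp_const_smul (fun y => u (l • z.1, y)) (l ^ (1 + μ)) z.2
  simp only [gradMuNorm, pairNorm, gradMu, grushinDilation_apply, Function.comp_apply, h1, h2,
    norm_smul, norm_of_nonneg hl.le, norm_of_nonneg hm.le,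
    norm_of_nonneg (rpow_nonneg (norm_nonneg z.1) μ)]
  rw [norm_of_nonneg (by positivity), mul_rpow hl.le (norm_nonneg _), rpow_add hl, rpow_one]
  have hsq (X : ℝ) : l * √X = √(l ^ 2 * X) := by rw [sqrt_mul (sq_nonneg l), sqrt_sq hl.le]
  rw [hsq]
  congr 1
  ring

/-- Scaling of the weighted Lebesgue integrals of the Caffarelli–Kohn–Nirenberg inequality. -/
lemma integral_weight_comp_grushinDilation {μ : ℝ} (hμ : 0 < μ) {d k : ℕ} {l : ℝ} (hl : 0 < l)
    (u : EuclideanSpace ℝ (Fin d) × EuclideanSpace ℝ (Fin k) → ℝ) (A B s : ℝ) :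
    ∫ z, (‖z.1‖ ^ μ / grho μ z ^ μ) ^ A * grho μ z ^ B *
        |(u ∘ grushinDilation μ d k hl) z| ^ s =
      l ^ (-B - (d + (1 + μ) * k)) *
        ∫ z, (‖z.1‖ ^ μ / grho μ z ^ μ) ^ A * grho μ z ^ B * |u z| ^ s := by
  refine integral_eq_of_homogeneous μ hl B fun z => ?_
  have h1 : ‖(grushinDilation μ d k hl z).1‖ = l * ‖z.1‖ := by
    rw [grushinDilation_apply, norm_smul, norm_of_nonneg hl.le]
  rw [grho_grushinDilation hμ, h1, mul_rpow hl.le (norm_nonneg _),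
    mul_rpow hl.le (grho_nonneg μ z), mul_rpow hl.le (grho_nonneg μ z),
    mul_div_mul_left _ _ (rpow_pos_of_pos hl μ).ne', Function.comp_apply]
  ring

/-- Scaling of the weighted Dirichlet integral. -/
lemma integral_gradMuNorm_comp_grushinDilation {μ : ℝ} (hμ : 0 < μ) {d k : ℕ} {l : ℝ}
    (hl : 0 < l) (u : EuclideanSpace ℝ (Fin d) × EuclideanSpace ℝ (Fin k) → ℝ) (B p : ℝ) :
    ∫ z, grho μ z ^ B * gradMuNorm μ (u ∘ grushinDilation μ d k hl) z ^ p =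
      l ^ (-(B - p) - (d + (1 + μ) * k)) * ∫ z, grho μ z ^ B * gradMuNorm μ u z ^ p := by
  refine integral_eq_of_homogeneous μ hl (B - p) fun z => ?_
  have h0 : 0 ≤ gradMuNorm μ u (grushinDilation μ d k hl z) := sqrt_nonneg _
  rw [gradMuNorm_comp_grushinDilation, grho_grushinDilation hμ, mul_rpow hl.le (grho_nonneg μ z),
    mul_rpow hl.le h0, rpow_sub hl]
  have := (rpow_pos_of_pos hl p).ne'
  field_simp

/-- A smooth compactly supported function whose weighted integral converges and is positive. -/
lemma exists_integral_weight_pos {μ : ℝ} (hμ : 0 < μ) {d : ℕ} (hd : 1 ≤ d) (k : ℕ) (A B : ℝ)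
    {s : ℝ} (hs : 0 < s) :
    ∃ u : EuclideanSpace ℝ (Fin d) × EuclideanSpace ℝ (Fin k) → ℝ,
      ContDiff ℝ (⊤ : ℕ∞) u ∧ HasCompactSupport u ∧
        0 < ∫ z, (‖z.1‖ ^ μ / grho μ z ^ μ) ^ A * grho μ z ^ B * |u z| ^ s := by
  let c : EuclideanSpace ℝ (Fin d) × EuclideanSpace ℝ (Fin k) :=
    (EuclideanSpace.single ⟨0, hd⟩ 1, 0)
  have hc : c.1 ≠ 0 := by simp [c]
  have hopen : IsOpen {z : EuclideanSpace ℝ (Fin d) × EuclideanSpace ℝ (Fin k) | z.1 ≠ 0} :=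
    isOpen_ne_fun continuous_fst continuous_const
  obtain ⟨u, hsupp, hcomp, hsmooth, -, huc⟩ :=
    exists_contDiff_tsupport_subset (n := ⊤) (hopen.mem_nhds hc)
  refine ⟨u, hsmooth, hcomp, ?_⟩
  refine Continuous.integral_pos_of_hasCompactSupport_nonneg_nonzero (x := c) ?_ ?_ ?_ ?_
  · refine continuous_iff_continuousAt.2 fun z => ?_
    by_cases hz : z.1 = 0
    · have hzu : z ∉ tsupport u := fun h => hsupp h hz
      refine (continuousAt_const (y := (0 : ℝ))).congr ?_
      filter_upwards [notMem_tsupport_iff_eventuallyEq.1 hzu] with w hw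
      simp [hw, hs.ne']
    · have hρ := grho_pos (μ := μ) hz
      have hx := norm_pos_iff.2 hz
      have hρc : ContinuousAt (grho μ) z := (continuous_grho hμ d k).continuousAt
      have hxc : ContinuousAt
          (fun z : EuclideanSpace ℝ (Fin d) × EuclideanSpace ℝ (Fin k) => ‖z.1‖) z := by fun_prop
      have hratio := ((hxc.rpow_const (p := μ) (.inl hx.ne')).div
        (hρc.rpow_const (p := μ) (.inl hρ.ne')) (rpow_pos_of_pos hρ μ).ne').rpow_const (p := A)
        (.inl (div_pos (rpow_pos_of_pos hx μ) (rpow_pos_of_pos hρ μ)).ne')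
      exact (hratio.mul (hρc.rpow_const (.inl hρ.ne'))).mul
        (hsmooth.continuous.continuousAt.abs.rpow_const (.inr hs.le))
  · refine hcomp.mono fun z hz => ?_
    contrapose! hz
    simp only [Function.mem_support, not_not] at hz
    simp [hz, hs.ne']
  · intro z
    have := grho_nonneg μ z
    simp only [Pi.zero_apply]
    positivity
  · have hρ := grho_pos (μ := μ) hc
    have hx := norm_pos_iff.2 hc
    rw [huc]
    positivity

/-- Powers that compare up to a constant on all of `(0, ∞)` have equal exponents. -/
lemma eq_of_forall_mul_rpow_le {A K s t : ℝ} (hA : 0 < A)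
    (h : ∀ l : ℝ, 0 < l → l ^ s * A ≤ K * l ^ t) : s = t := by
  by_contra hst
  have hK : 0 < K := hA.trans_le (by simpa using h 1 one_pos)
  have hst' : t - s ≠ 0 := sub_ne_zero.2 (Ne.symm hst)
  have hb : 0 < A / (2 * K) := by positivity
  set l := (A / (2 * K)) ^ (t - s)⁻¹ with hldef
  have hl : 0 < l := rpow_pos_of_pos hb _
  have hls : l ^ t = A / (2 * K) * l ^ s := by
    rw [← rpow_inv_rpow hb.le hst', ← hldef, ← rpow_add hl]; congr 1; ring
  have h1 := h l hl
  have h2 : K * l ^ t = l ^ s * A / 2 := by rw [hls]; field_simp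
  have h3 : 0 < l ^ s * A := by positivity
  linarith

/-- Necessity of the dimensional balance in the weighted CKN inequality. -/
theorem weighted_CKN_grushin_necessity_balance
    (d k : ℕ) (hd : 1 ≤ d) (hk : 1 ≤ k) (μ : ℝ) (hμ : 0 < μ)
    (Q : ℝ) (hQ : Q = d + (1 + μ) * k)
    (p q r a α β σ γ : ℝ)
    (hγ : γ = a * σ + (1 - a) * β)
    (hp1 : 1 < p) (hpQ : p < Q) (hq : 1 ≤ q) (hr : 0 < r)
    (h1 : 0 < d + μ * (α - γ) * r) (h2 : 0 < d + μ * (α - β) * q)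
    (h3 : 0 < α * p + Q) (h4 : 0 < β * q + Q) (h5 : 0 < γ * r + Q)
    (ha0 : 0 ≤ a) (ha1 : a ≤ 1)
    (hCKN : ∃ C : ℝ, 0 < C ∧
        ∀ u : EuclideanSpace ℝ (Fin d) × EuclideanSpace ℝ (Fin k) → ℝ,
          ContDiff ℝ (⊤ : ℕ∞) u → HasCompactSupport u →
          (∫ z, (‖z.1‖ ^ μ / grho μ z ^ μ) ^ ((α - γ) * r) * grho μ z ^ (γ * r) * |u z| ^ r) ^ (1 / r)
            ≤ C * (∫ z, grho μ z ^ (α * p) * gradMuNorm μ u z ^ p) ^ (a / p) *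
              (∫ z, (‖z.1‖ ^ μ / grho μ z ^ μ) ^ ((α - β) * q) * grho μ z ^ (β * q) * |u z| ^ q) ^
                ((1 - a) / q)) :
    1 / r + γ / Q = a * (1 / p + (α - 1) / Q) + (1 - a) * (1 / q + β / Q) := by
  obtain ⟨C, hC, h⟩ := hCKN
  obtain ⟨u, hsm, hcs, hpos⟩ :=
    exists_integral_weight_pos hμ hd k ((α - γ) * r) (γ * r) hr
  have hQ0 : 0 < Q := by linarith
  set L := ∫ z : EuclideanSpace ℝ (Fin d) × EuclideanSpace ℝ (Fin k),
    (‖z.1‖ ^ μ / grho μ z ^ μ) ^ ((α - γ) * r) * grho μ z ^ (γ * r) * |u z| ^ r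
  set G := ∫ z : EuclideanSpace ℝ (Fin d) × EuclideanSpace ℝ (Fin k),
    grho μ z ^ (α * p) * gradMuNorm μ u z ^ p with hG
  set R := ∫ z : EuclideanSpace ℝ (Fin d) × EuclideanSpace ℝ (Fin k),
    (‖z.1‖ ^ μ / grho μ z ^ μ) ^ ((α - β) * q) * grho μ z ^ (β * q) * |u z| ^ q with hR
  have hG0 : 0 ≤ G := integral_nonneg fun z => mul_nonneg (rpow_nonneg (grho_nonneg μ z) _)
    (rpow_nonneg (sqrt_nonneg _) _)
  have hR0 : 0 ≤ R := integral_nonneg fun z => by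
    have := grho_nonneg μ z
    simp only [Pi.zero_apply]
    positivity
  have key : (-(γ * r) - Q) * (1 / r) =
      (-(α * p - p) - Q) * (a / p) + (-(β * q) - Q) * ((1 - a) / q) := by
    refine eq_of_forall_mul_rpow_le (A := L ^ (1 / r))
      (K := C * G ^ (a / p) * R ^ ((1 - a) / q)) (rpow_pos_of_pos hpos _) fun l hl => ?_
    have hl' := h (u ∘ grushinDilation μ d k hl) (hsm.comp (contDiff_grushinDilation μ d k hl))
      (hcs.comp_homeomorph _)
    rw [integral_weight_comp_grushinDilation hμ hl, integral_weight_comp_grushinDilation hμ hl,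
      integral_gradMuNorm_comp_grushinDilation hμ hl, ← hQ, ← hG, ← hR,
      mul_rpow (by positivity) hpos.le, mul_rpow (by positivity) hG0,
      mul_rpow (by positivity) hR0, ← rpow_mul hl.le, ← rpow_mul hl.le, ← rpow_mul hl.le] at hl'
    rw [rpow_add hl]
    exact hl'.trans_eq (by ring)
  have hp0 : p ≠ 0 := by positivity
  have hq0 : q ≠ 0 := by positivity
  field_simp at key ⊢
  linarith
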